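/- arXiv:1202.0343 — 2 statements merged into one kernel-verified Lean document; each statement's English description precedes it below -/
import Mathlib

section
/- Let w, r and r₁,...,r_w be integers with 0 ≤ r_j ≤ r. Define the block matrix T = [T_{i,j}], where T_{i,j} is an r×r_j matrix over F₂ whose entries are independent uniform bits if j ≤ i, and an arbitrary (deterministic) r×r_j matrix if i < j. Let n = Σ_{j=1}^w r_j, r_max = max_j r_j, r_min = min_j r_j, and u = ⌈(n−γ)/r_min⌉. Then for every integer 0 ≤ γ ≤ n−1, Pr[rank(T) < n−γ] ≤ u · (1 − 2^{−r_max}) · 2^{−γ + n − wr + (r − r_min)(u−1)}. -/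
open MeasureTheory ProbabilityTheory

noncomputable instance : MeasurableSpace (ZMod 2) := ⊤

section

open Finset Matrix

/-- A matrix with prescribed entries `g` on `S` and `A` elsewhere. -/
def fillMatrix {I C : Type*} [DecidableEq I] [DecidableEq C] (S : Finset (I × C))
    (A : I → C → ZMod 2) (g : S → ZMod 2) : Matrix I C (ZMod 2) :=
  fun i c => if h : (i, c) ∈ S then g ⟨(i, c), h⟩ else A i c

theorem card_fillMatrix_mulVec_eq_zero_mul_le {I C : Type*} [DecidableEq I] [DecidableEq C]
    [Fintype I] [Fintype C] (S : Finset (I × C)) (A : I → C → ZMod 2) (x : C → ZMod 2) (c₀ : C)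
    (hx : x c₀ ≠ 0) (R : Finset I) (hR : ∀ i ∈ R, (i, c₀) ∈ S) :
    #{g : S → ZMod 2 | fillMatrix S A g *ᵥ x = 0} * 2 ^ #R ≤ 2 ^ #S := by
  let shift : (R → ZMod 2) → S → ZMod 2 := fun h p =>
    if hp : p.1.1 ∈ R ∧ p.1.2 = c₀ then h ⟨p.1.1, hp.1⟩ else 0
  have key : ∀ g h (i : R), (fillMatrix S A (g + shift h) *ᵥ x) i
      = (fillMatrix S A g *ᵥ x) i + h i * x c₀ := by
    intro g h i
    have h1 : ∀ c, fillMatrix S A (g + shift h) i c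
        = fillMatrix S A g i c + if c = c₀ then h i else 0 := by
      intro c
      by_cases hc : c = c₀
      · subst hc
        simp [fillMatrix, hR i i.2, shift]
      · by_cases hS : ((i : I), c) ∈ S <;> simp [fillMatrix, hS, shift, hc]
    simp [mulVec, dotProduct, h1, add_mul, sum_add_distrib]
  have hcard : #(({g : S → ZMod 2 | fillMatrix S A g *ᵥ x = 0} : Finset _) ×ˢ
      (univ : Finset (R → ZMod 2))) ≤ #(univ : Finset (S → ZMod 2)) := by
    refine card_le_card_of_injOn (fun p => p.1 + shift p.2) (by simp) ?_
    rintro ⟨g, h⟩ hg ⟨g', h'⟩ hg' heq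
    simp only [coe_product, coe_filter, mem_univ, true_and, Set.mem_prod, Set.mem_ofPred_eq] at hg hg'
    have hh : h = h' := by
      funext i
      have e1 := key g h i
      have e2 := key g' h' i
      have : g + shift h = g' + shift h' := heq
      rw [this, e2, hg.1, hg'.1] at e1
      simpa [hx] using e1.symm
    subst hh
    simpa using heq
  simpa [card_product, ZMod.card] using hcard

theorem measureReal_mulVec_eq_zero_le {Ω I C : Type*} [MeasurableSpace Ω] (μ : Measure Ω)
    [IsProbabilityMeasure μ] [DecidableEq I] [DecidableEq C] [Fintype I] [Fintype C]
    (S : Finset (I × C)) (A : I → C → ZMod 2) (f : Ω → S → ZMod 2)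
    (hf : μ.map f = (PMF.uniformOfFintype (S → ZMod 2)).toMeasure)
    (x : C → ZMod 2) (c₀ : C) (hx : x c₀ ≠ 0) (R : Finset I) (hR : ∀ i ∈ R, (i, c₀) ∈ S) :
    μ.real {ω | fillMatrix S A (f ω) *ᵥ x = 0} ≤ ((2 : ℝ) ^ #R)⁻¹ := by
  have : MeasurableSingletonClass (ZMod 2) := ⟨fun _ => trivial⟩
  have hfm : AEMeasurable f μ := by
    by_contra h
    rw [Measure.map_of_not_aemeasurable h] at hf
    have := congrArg (fun ν => ν Set.univ) hf
    simp at this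
  have hcount := card_fillMatrix_mulVec_eq_zero_mul_le S A x c₀ hx R hR
  set E : Finset (S → ZMod 2) := {g | fillMatrix S A g *ᵥ x = 0}
  have hset : {ω | fillMatrix S A (f ω) *ᵥ x = 0} = f ⁻¹' (E : Set (S → ZMod 2)) := by
    ext ω; simp [E]
  have hμ : μ.real {ω | fillMatrix S A (f ω) *ᵥ x = 0} = (#E : ℝ) / 2 ^ #S := by
    rw [hset, measureReal_def, ← Measure.map_apply_of_aemeasurable hfm E.measurableSet, hf,
      PMF.toMeasure_uniformOfFintype_apply _ E.measurableSet]
    simp [ZMod.card]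
  rw [hμ, div_le_iff₀ (by positivity), ← div_eq_inv_mul, le_div_iff₀ (by positivity)]
  exact_mod_cast hcount

theorem exists_card_eq_forall_lt_mem {C : Type*} [Fintype C] [DecidableEq C] (b : C → ℕ) (m : ℕ)
    (hm : m ≤ Fintype.card C) :
    ∃ D : Finset C, #D = m ∧ ∀ c ∈ D, ∀ c', b c' < b c → c' ∈ D := by
  induction m with
  | zero => exact ⟨∅, by simp⟩
  | succ m ih =>
    obtain ⟨D, hD, hlow⟩ := ih (by omega)
    have hne : (Dᶜ).Nonempty := by
      rw [← card_pos, card_compl]; omega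
    obtain ⟨a, ha, hmin⟩ := exists_min_image Dᶜ b hne
    rw [mem_compl] at ha
    refine ⟨insert a D, by rw [card_insert_of_notMem ha, hD], ?_⟩
    intro c hc c' hlt
    rcases mem_insert.1 hc with rfl | hc
    · by_contra hc'
      have := hmin c' (by simp_all)
      omega
    · exact mem_insert_of_mem (hlow c hc c' hlt)

theorem exists_mulVec_eq_zero_of_rank_lt {I C K : Type*} [Fintype I] [Fintype C] [DecidableEq C]
    [Field K] (M : Matrix I C K) (D : Finset C) (hM : M.rank < #D) :
    ∃ x : C → K, x ≠ 0 ∧ (∀ c ∉ D, x c = 0) ∧ M *ᵥ x = 0 := by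
  let L := M.mulVecLin ∘ₗ Function.ExtendByZero.linearMap K (Subtype.val : D → C)
  have hL : ¬ Function.Injective L := by
    intro hinj
    have h1 := LinearMap.finrank_range_of_inj hinj
    have h2 : Module.finrank K (LinearMap.range L) ≤ M.rank :=
      Submodule.finrank_mono (LinearMap.range_comp_le_range _ _)
    simp at h1
    omega
  rw [← LinearMap.ker_eq_bot, ← ne_eq, Submodule.ne_bot_iff] at hL
  obtain ⟨y, hy, hy0⟩ := hL
  refine ⟨Function.extend Subtype.val y 0, ?_, ?_, ?_⟩
  · intro h
    apply hy0
    funext c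
    have := congrFun h c.1
    rwa [Subtype.val_injective.extend_apply] at this
  · intro c hc
    rw [Function.extend_apply' _ _ _ (by rintro ⟨a, rfl⟩; exact hc a.2)]
    rfl
  · exact hy

/-- The vectors supported on `D`. -/
def vectorsOn {C : Type*} [Fintype C] [DecidableEq C] (D : Finset C) : Finset (C → ZMod 2) :=
  {x | ∀ c ∉ D, x c = 0}

theorem card_vectorsOn {C : Type*} [Fintype C] [DecidableEq C] (D : Finset C) :
    #(vectorsOn D) = 2 ^ #D := by
  have : vectorsOn D = Fintype.piFinset (fun c => if c ∈ D then univ else {0}) := by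
    ext x
    simp only [vectorsOn, mem_filter, mem_univ, true_and, Fintype.mem_piFinset]
    refine forall_congr' fun c => ?_
    by_cases h : c ∈ D <;> simp [h]
  rw [this, Fintype.card_piFinset]
  simp [apply_ite card, ZMod.card]

theorem card_vectorsOn_sdiff_le {C : Type*} [Fintype C] [DecidableEq C] {D D' : Finset C}
    (hsub : D' ⊆ D) (k : ℕ) (hk : #D ≤ #D' + k) :
    (#(vectorsOn D \ vectorsOn D') : ℝ) ≤ 2 ^ #D * (1 - (2 ^ k)⁻¹) := by
  have hV : vectorsOn D' ⊆ vectorsOn D := by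
    intro x hx
    simp only [vectorsOn, mem_filter, mem_univ, true_and] at hx ⊢
    exact fun c hc => hx c fun h => hc (hsub h)
  rw [cast_card_sdiff hV, card_vectorsOn, card_vectorsOn]
  have : (2 : ℝ) ^ #D * (2 ^ k)⁻¹ ≤ 2 ^ #D' := by
    rw [← div_eq_mul_inv, div_le_iff₀ (by positivity), ← pow_add]
    exact pow_le_pow_right₀ (by norm_num) hk
  push_cast
  linarith

theorem card_filter_le_div (w r j : ℕ) (hr : 0 < r) :
    #{i : Fin (w * r) | j ≤ i.val / r} = (w - j) * r := by
  have h1 : (univ.filter fun i : Fin (w * r) => j ≤ i.val / r)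
      = (univ.filter fun i : Fin (w * r) => i.val < j * r)ᶜ := by
    ext i
    simp [Nat.le_div_iff_mul_le hr]
  rw [h1, card_compl, Fin.card_filter_val_lt, Fintype.card_fin, Nat.sub_mul]
  omega

theorem mul_add_card_filter_le {w : ℕ} (rs : Fin w → ℕ) (rmin : ℕ) (hmin : ∀ j, rmin ≤ rs j)
    (D : Finset ((j : Fin w) × Fin (rs j)))
    (hD : ∀ c ∈ D, ∀ c' : (j : Fin w) × Fin (rs j), c'.1.val < c.1.val → c' ∈ D) (j : ℕ)
    (hne : (D.filter fun c => j ≤ c.1.val).Nonempty) :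
    j * rmin + #(D.filter fun c => j ≤ c.1.val) ≤ #D := by
  obtain ⟨c, hc⟩ := hne
  rw [mem_filter] at hc
  have hjw : j ≤ w := hc.2.trans c.1.isLt.le
  have hlow : j * rmin ≤ #(D.filter fun c => ¬ j ≤ c.1.val) := by
    have : (D.filter fun c => ¬ j ≤ c.1.val)
        = (univ.filter fun k : Fin w => k.val < j).sigma fun _ => univ := by
      ext c'
      simp only [mem_filter, mem_sigma, mem_univ, true_and, and_true, not_le, and_iff_right_iff_imp]
      exact fun h => hD c hc.1 c' (by omega)
    rw [this, card_sigma]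
    calc j * rmin = #{k : Fin w | k.val < j} • rmin := by
          rw [Fin.card_filter_val_lt, min_eq_right hjw, smul_eq_mul]
      _ ≤ _ := card_nsmul_le_sum _ _ _ fun k _ => by simpa using hmin k
  have := card_filter_add_card_filter_not (s := D) fun c => j ≤ c.1.val
  omega

theorem card_filter_le_card_filter_succ_add {w : ℕ} (rs : Fin w → ℕ) (rmax : ℕ)
    (hmax : ∀ j, rs j ≤ rmax) (D : Finset ((j : Fin w) × Fin (rs j))) (j : ℕ) :
    #(D.filter fun c => j ≤ c.1.val) ≤ #(D.filter fun c => j + 1 ≤ c.1.val) + rmax := by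
  have hblock : #(univ.filter fun c : (j : Fin w) × Fin (rs j) => c.1.val = j) ≤ rmax := by
    have : (univ.filter fun c : (j : Fin w) × Fin (rs j) => c.1.val = j)
        = (univ.filter fun k : Fin w => k.val = j).sigma fun _ => univ := by
      ext c; simp
    rw [this, card_sigma]
    calc _ ≤ #{k : Fin w | k.val = j} • rmax :=
          sum_le_card_nsmul _ _ _ fun k _ => by simpa using hmax k
      _ ≤ 1 * rmax := by
          rw [smul_eq_mul]
          gcongr
          refine card_le_one.2 fun a ha b hb => Fin.ext ?_
          simp only [mem_filter, mem_univ, true_and] at ha hb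
          rw [ha, hb]
      _ = rmax := one_mul _
  refine (card_le_card (t := (D.filter fun c => j + 1 ≤ c.1.val) ∪
    univ.filter fun c : (j : Fin w) × Fin (rs j) => c.1.val = j) ?_).trans
    ((card_union_le _ _).trans (by omega))
  intro c hc
  simp only [mem_union, mem_filter, mem_univ, true_and] at hc ⊢
  by_cases h : c.1.val = j
  · exact Or.inr h
  · exact Or.inl ⟨hc.1, by omega⟩

theorem exists_mem_vectorsOn_sdiff {C : Type*} [Fintype C] [DecidableEq C] (b : C → ℕ)
    (D : Finset C) (x : C → ZMod 2) (hx : x ≠ 0) (hD : ∀ c ∉ D, x c = 0) :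
    ∃ c ∈ D, x ∈ vectorsOn (D.filter fun c' => b c ≤ b c') \
      vectorsOn (D.filter fun c' => b c + 1 ≤ b c') := by
  obtain ⟨c₀, hc₀⟩ := Function.ne_iff.1 hx
  obtain ⟨c, hc, hmin⟩ := exists_min_image ({c | x c ≠ 0} : Finset C) b ⟨c₀, by simpa using hc₀⟩
  simp only [mem_filter, mem_univ, true_and] at hc hmin
  refine ⟨c, by_contra fun h => hc (hD c h), ?_⟩
  simp only [vectorsOn, mem_sdiff, mem_filter, mem_univ, true_and, not_and, not_forall]
  refine ⟨fun c' hc' => ?_, c, by simp, hc⟩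
  by_contra h
  exact hc' (by_contra fun hD' => h (hD c' hD')) (hmin c' h)

theorem exists_ne_zero_of_mem_vectorsOn_sdiff {C : Type*} [Fintype C] [DecidableEq C] {b : C → ℕ}
    {D : Finset C} {j : ℕ} {x : C → ZMod 2}
    (hx : x ∈ vectorsOn (D.filter fun c => j ≤ b c) \ vectorsOn (D.filter fun c => j + 1 ≤ b c)) :
    ∃ c ∈ D, b c = j ∧ x c ≠ 0 := by
  simp only [vectorsOn, mem_sdiff, mem_filter, mem_univ, true_and, not_forall] at hx
  obtain ⟨hx, c, hc, hxc⟩ := hx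
  have h : c ∈ D ∧ j ≤ b c := by_contra fun h => hxc (hx c h)
  refine ⟨c, h.1, ?_, hxc⟩
  by_contra hb
  exact hc ⟨h.1, by omega⟩

end

/-- Lemma VerticalT: T = [T_{i,j}] is a (wr)×n block matrix over F₂,
with w block-rows of height r and w block-columns of widths r₁,…,r_w (each r_j ≤ r),
n = Σ_j r_j. Columns are indexed by the sigma type (j : Fin w) × Fin (rs j); the
block-row of a row index i is i/r. Blocks T_{i,j} with j ≤ i have jointly i.i.d.
uniform entries; blocks with i < j are arbitrary fixed (deterministic) matrices.
Then for 0 ≤ γ ≤ n−1, with u = ⌈(n−γ)/r_min⌉,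
Pr[rank(T) < n−γ] ≤ u·(1−2^{−r_max})·2^{−γ+n−wr+(r−r_min)(u−1)}. -/
theorem rank_lower_tail_vertical_blocks {Ω : Type} [MeasurableSpace Ω]
    (μ : Measure Ω) [IsProbabilityMeasure μ]
    (w r : ℕ) (hw : 0 < w) (rs : Fin w → ℕ) (hrs : ∀ j, rs j ≤ r)
    (rmax rmin : ℕ)
    (hrmax : IsGreatest (Set.range rs) rmax) (hrmin : IsLeast (Set.range rs) rmin)
    (hrmin1 : 1 ≤ rmin)
    (n : ℕ) (hn : n = ∑ j, rs j)
    (T : Ω → Fin (w * r) → ((j : Fin w) × Fin (rs j)) → ZMod 2)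
    (S : Finset (Fin (w * r) × ((j : Fin w) × Fin (rs j))))
    (hS : ∀ p : Fin (w * r) × ((j : Fin w) × Fin (rs j)),
      p ∈ S ↔ p.2.1.val ≤ p.1.val / r)
    (hunif : μ.map (fun ω (p : S) => T ω p.1.1 p.1.2)
      = (PMF.uniformOfFintype (S → ZMod 2)).toMeasure)
    (A : Fin (w * r) → ((j : Fin w) × Fin (rs j)) → ZMod 2)
    (hdet : ∀ ω i c, (i, c) ∉ S → T ω i c = A i c)
    (γ : ℕ) (hγ : γ ≤ n - 1) (u : ℕ) (hu : u = (n - γ + rmin - 1) / rmin) :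
    (μ {ω | (Matrix.of (T ω)).rank < n - γ}).toReal
      ≤ (u : ℝ) * (1 - 2 ^ (-(rmax : ℤ)))
        * 2 ^ (-(γ : ℤ) + (n : ℤ) - (w : ℤ) * r + ((r : ℤ) - rmin) * ((u : ℤ) - 1)) := by
  classical
  have hmin : ∀ j, rmin ≤ rs j := fun j => hrmin.2 ⟨j, rfl⟩
  have hmax : ∀ j, rs j ≤ rmax := fun j => hrmax.2 ⟨j, rfl⟩
  have hminr : rmin ≤ r := (hmin ⟨0, hw⟩).trans (hrs _)
  have hn1 : 1 ≤ n := by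
    have := Finset.single_le_sum (f := rs) (fun _ _ => Nat.zero_le _) (Finset.mem_univ ⟨0, hw⟩)
    have := hmin ⟨0, hw⟩
    omega
  obtain ⟨D, hDcard, hD⟩ := exists_card_eq_forall_lt_mem
    (fun c : (j : Fin w) × Fin (rs j) => c.1.val) (n - γ) (by simp [← hn])
  let X : ℕ → Finset (((j : Fin w) × Fin (rs j)) → ZMod 2) := fun j =>
    vectorsOn (D.filter fun c => j ≤ c.1.val) \ vectorsOn (D.filter fun c => j + 1 ≤ c.1.val)
  let N : ((((j : Fin w) × Fin (rs j)) → ZMod 2)) → Set Ω := fun x =>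
    {ω | Matrix.mulVec (fillMatrix S A fun p => T ω p.1.1 p.1.2) x = 0}
  have hT : ∀ ω, Matrix.of (T ω) = fillMatrix S A fun p => T ω p.1.1 p.1.2 := by
    intro ω
    ext i c
    by_cases h : (i, c) ∈ S <;> simp [fillMatrix, h, hdet ω i c]
  have hcover : {ω | (Matrix.of (T ω)).rank < n - γ}
      ⊆ ⋃ j ∈ Finset.range u, ⋃ x ∈ X j, N x := by
    intro ω hω
    obtain ⟨x, hx0, hxD, hx⟩ := exists_mulVec_eq_zero_of_rank_lt _ D (hDcard ▸ hω)
    obtain ⟨c, hcD, hxc⟩ := exists_mem_vectorsOn_sdiff (fun c => c.1.val) D x hx0 hxD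
    have hc : c ∈ D.filter fun c' => c.1.val ≤ c'.1.val := by simp [hcD]
    have h1 := mul_add_card_filter_le rs rmin hmin D hD c.1.val ⟨c, hc⟩
    have h2 := Finset.card_pos.2 ⟨c, hc⟩
    simp only [Set.mem_iUnion, exists_prop]
    rw [hT ω] at hx
    refine ⟨c.1.val, ?_, x, hxc, hx⟩
    rw [Finset.mem_range, hu, ← Nat.succ_le_iff, Nat.le_div_iff_mul_le (by omega), Nat.succ_mul]
    omega
  have hrmax1 : (2 : ℝ) ^ (-(rmax : ℤ)) ≤ 1 := zpow_le_one_of_nonpos₀ (by norm_num) (by simp)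
  have hblock : ∀ j ∈ Finset.range u, μ.real (⋃ x ∈ X j, N x) ≤ (1 - 2 ^ (-(rmax : ℤ)))
      * 2 ^ (-(γ : ℤ) + (n : ℤ) - (w : ℤ) * r + ((r : ℤ) - rmin) * ((u : ℤ) - 1)) := by
    intro j hj
    rw [Finset.mem_range] at hj
    refine (measureReal_biUnion_finset_le _ _).trans ?_
    rcases (X j).eq_empty_or_nonempty with hX | ⟨x₀, hx₀⟩
    · rw [hX, Finset.sum_empty]
      exact mul_nonneg (by linarith) (by positivity)
    obtain ⟨c, hcD, hcj, -⟩ := exists_ne_zero_of_mem_vectorsOn_sdiff hx₀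
    have hjw : j < w := hcj ▸ c.1.isLt
    have hN : ∀ x ∈ X j, μ.real (N x) ≤ ((2 : ℝ) ^ ((w - j) * r))⁻¹ := by
      intro x hx
      obtain ⟨c', -, hc'j, hxc'⟩ := exists_ne_zero_of_mem_vectorsOn_sdiff hx
      have := measureReal_mulVec_eq_zero_le μ S A _ hunif x c' hxc'
        (Finset.univ.filter fun i : Fin (w * r) => j ≤ i.val / r)
        (fun i hi => (hS _).2 (by simpa [hc'j] using hi))
      rwa [card_filter_le_div w r j (by omega)] at this
    have hsub : (D.filter fun c => j + 1 ≤ c.1.val) ⊆ D.filter fun c => j ≤ c.1.val :=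
      Finset.monotone_filter_right _ fun c _ h => (Nat.le_succ j).trans h
    have hcardX := card_vectorsOn_sdiff_le hsub rmax
      (card_filter_le_card_filter_succ_add rs rmax hmax D j)
    have hcardD := mul_add_card_filter_le rs rmin hmin D hD j ⟨c, by simp [hcD, hcj]⟩
    set d := (D.filter fun c => j ≤ c.1.val).card
    calc ∑ x ∈ X j, μ.real (N x) ≤ (X j).card * ((2 : ℝ) ^ ((w - j) * r))⁻¹ := by
          simpa using Finset.sum_le_card_nsmul _ _ _ hN
      _ ≤ 2 ^ d * (1 - (2 ^ rmax)⁻¹) * ((2 : ℝ) ^ ((w - j) * r))⁻¹ := by gcongr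
      _ = (1 - 2 ^ (-(rmax : ℤ))) * 2 ^ ((d : ℤ) - ((w - j) * r : ℕ)) := by
          rw [zpow_sub₀ (by norm_num), zpow_neg, zpow_natCast, zpow_natCast, zpow_natCast]
          ring
      _ ≤ _ := by
          refine mul_le_mul_of_nonneg_left (zpow_le_zpow_right₀ (by norm_num) ?_) (by linarith)
          have h1 : (j : ℤ) * rmin + d ≤ n - γ := by
            rw [hDcard] at hcardD
            zify [show γ ≤ n by omega] at hcardD
            exact hcardD
          have h2 : ((r : ℤ) - rmin) * j ≤ (r - rmin) * (u - 1) :=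
            mul_le_mul_of_nonneg_left (by omega) (by omega)
          push_cast [hjw.le]
          linarith
  calc μ.real {ω | (Matrix.of (T ω)).rank < n - γ}
      ≤ μ.real (⋃ j ∈ Finset.range u, ⋃ x ∈ X j, N x) := measureReal_mono hcover (measure_ne_top _ _)
    _ ≤ ∑ j ∈ Finset.range u, μ.real (⋃ x ∈ X j, N x) := measureReal_biUnion_finset_le _ _
    _ ≤ _ := (Finset.sum_le_card_nsmul _ _ _ hblock).trans_eq (by simp [mul_assoc])
end

section
/- Suppose a dense random linear code over F₂ is used over a line network of L ≥ 1 lossless links with one packet transmission per node per time unit for N_T time units. Then with probability at least 1 − ε, the density of the decoding matrix at the sink satisfies D(Q_L) ≥ N_T − L·log₂(N_T·L/ε). -/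
open MeasureTheory ProbabilityTheory

/-- **Sylvester's rank inequality** for square matrices over a field. -/
theorem Matrix.rank_add_rank_le_card_add_rank_mul {n F : Type*} [Fintype n] [Field F]
    (A B : Matrix n n F) : A.rank + B.rank ≤ Fintype.card n + (A * B).rank := by
  have hA := A.mulVecLin.finrank_range_add_finrank_ker
  have hB := (A.mulVecLin.domRestrict (LinearMap.range B.mulVecLin)).finrank_range_add_finrank_ker
  have hAB : LinearMap.range (A.mulVecLin.domRestrict (LinearMap.range B.mulVecLin))
      = LinearMap.range (A * B).mulVecLin := by
    rw [LinearMap.range_domRestrict, Matrix.mulVecLin_mul, LinearMap.range_comp]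
  have hker : Module.finrank F
      (LinearMap.ker (A.mulVecLin.domRestrict (LinearMap.range B.mulVecLin)))
      ≤ Module.finrank F (LinearMap.ker A.mulVecLin) := by
    refine LinearMap.finrank_le_finrank_of_injective
      (f := ((LinearMap.range B.mulVecLin).subtype.comp (Submodule.subtype _)).codRestrict
        (LinearMap.ker A.mulVecLin) fun x => ?_) ?_
    · exact x.2
    · intro x y hxy
      have h := congrArg (fun z : LinearMap.ker A.mulVecLin => z.1) hxy
      exact Subtype.ext (Subtype.ext h)
  rw [hAB] at hB
  rw [Module.finrank_fintype_fun_eq_card] at hA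
  change A.rank + _ = _ at hA
  change (A * B).rank + _ = B.rank at hB
  omega

/-- The rank defect of a product is at most the sum of the rank defects. -/
theorem Matrix.card_le_rank_prod_add_sum {n F : Type*} [Fintype n] [DecidableEq n] [Field F]
    (l : List (Matrix n n F)) :
    Fintype.card n ≤ l.prod.rank + (l.map fun A => Fintype.card n - A.rank).sum := by
  induction l with
  | nil => simp
  | cons A l ih =>
    have h := Matrix.rank_add_rank_le_card_add_rank_mul A l.prod
    have hA := A.rank_le_card_width
    simp only [List.prod_cons, List.map_cons, List.sum_cons]
    omega

/-- The kernel of a square matrix over a finite field has `|F| ^ (n - rank)` elements. -/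
theorem Matrix.natCard_ker_eq_pow {n F : Type*} [Fintype n] [Field F] [Finite F]
    (A : Matrix n n F) :
    Nat.card {v : n → F // A.mulVec v = 0} = Nat.card F ^ (Fintype.card n - A.rank) := by
  have hA := A.mulVecLin.finrank_range_add_finrank_ker
  rw [Module.finrank_fintype_fun_eq_card] at hA
  change A.rank + _ = _ at hA
  have h := Module.natCard_eq_pow_finrank (K := F) (V := LinearMap.ker A.mulVecLin)
  rw [← hA, Nat.add_sub_cancel_left, ← h]
  rfl

/-- The lower triangular matrix with prescribed entries on and below the diagonal. -/
def lowerTriangular {n : ℕ} {F : Type*} [Zero F]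
    (a : {p : Fin n × Fin n // p.2 ≤ p.1} → F) : Matrix (Fin n) (Fin n) F :=
  Matrix.of fun t s => if h : s ≤ t then a ⟨(t, s), h⟩ else 0

section Counting

variable {n : ℕ} {F : Type*} [Field F]

theorem lowerTriangular_add (a b : {p : Fin n × Fin n // p.2 ≤ p.1} → F) :
    lowerTriangular (a + b) = lowerTriangular a + lowerTriangular b := by
  ext t s
  by_cases h : s ≤ t <;> simp [lowerTriangular, h]

/-- The entries of a lower triangular matrix supported in column `s`. -/
def columnEntries (s : Fin n) (b : {t : Fin n // s ≤ t} → F)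
    (p : {p : Fin n × Fin n // p.2 ≤ p.1}) : F :=
  if h : p.1.2 = s then b ⟨p.1.1, h ▸ p.2⟩ else 0

theorem lowerTriangular_columnEntries_mulVec (s : Fin n) (b : {t : Fin n // s ≤ t} → F)
    (v : Fin n → F) (t : {t : Fin n // s ≤ t}) :
    (lowerTriangular (columnEntries s b)).mulVec v t = b t * v s := by
  rw [Matrix.mulVec, dotProduct, Finset.sum_eq_single s]
  · simp [lowerTriangular, columnEntries, t.2]
  · intro j _ hj
    simp [lowerTriangular, columnEntries, hj]
  · simp

variable [Fintype F] [DecidableEq F]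

theorem card_lowerTriangular_mulVec_eq_zero_mul_le (s : Fin n) (v : Fin n → F) (hv : v s ≠ 0) :
    Fintype.card {a : {p : Fin n × Fin n // p.2 ≤ p.1} → F // (lowerTriangular a).mulVec v = 0}
      * Fintype.card ({t : Fin n // s ≤ t} → F)
      ≤ Fintype.card ({p : Fin n × Fin n // p.2 ≤ p.1} → F) := by
  rw [← Fintype.card_prod]
  refine Fintype.card_le_of_injective (fun x => x.1.1 + columnEntries s x.2) ?_
  rintro ⟨⟨a, ha⟩, b⟩ ⟨⟨a', ha'⟩, b'⟩ h
  simp only at h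
  have hb : b = b' := by
    funext t
    have hm := congrFun (congrArg (fun a => (lowerTriangular a).mulVec v) h) t
    simp only [lowerTriangular_add, Matrix.add_mulVec, ha, ha', zero_add,
      lowerTriangular_columnEntries_mulVec] at hm
    exact mul_right_cancel₀ hv hm
  subst hb
  obtain rfl : a = a' := add_right_cancel h
  rfl

/-- The average size of the kernel of a uniformly random lower triangular matrix is at most
`n + 1`. -/
theorem sum_card_ker_lowerTriangular_le :
    ∑ a : {p : Fin n × Fin n // p.2 ≤ p.1} → F,
      Nat.card {v : Fin n → F // (lowerTriangular a).mulVec v = 0}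
      ≤ (n + 1) * Fintype.card ({p : Fin n × Fin n // p.2 ≤ p.1} → F) := by
  classical
  set N := Fintype.card ({p : Fin n × Fin n // p.2 ≤ p.1} → F) with hN
  let k : (Fin n → F) → ℕ := fun v => Fintype.card
    {a : {p : Fin n × Fin n // p.2 ≤ p.1} → F // (lowerTriangular a).mulVec v = 0}
  let V : Fin n → Finset (Fin n → F) := fun s => {v | v s ≠ 0 ∧ ∀ t < s, v t = 0}
  have hswap : ∑ a : {p : Fin n × Fin n // p.2 ≤ p.1} → F,
      Nat.card {v : Fin n → F // (lowerTriangular a).mulVec v = 0} = ∑ v, k v := by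
    simp only [k, Nat.card_eq_fintype_card, Fintype.card_subtype, Finset.card_filter]
    exact Finset.sum_comm
  have hzero : k 0 = N := by
    simp [k, hN]
  have hV (s : Fin n) : ∑ v ∈ V s, k v ≤ N := by
    set m := Fintype.card ({t : Fin n // s ≤ t} → F)
    have hm : 0 < m := Fintype.card_pos
    have hcard : (V s).card ≤ m := by
      rw [← Fintype.card_coe]
      refine Fintype.card_le_of_injective (fun v t => v.1 t.1) ?_
      rintro ⟨v, hv⟩ ⟨w, hw⟩ h
      simp only [V, Finset.mem_filter, Finset.mem_univ, true_and] at hv hw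
      refine Subtype.ext (funext fun t => ?_)
      rcases lt_or_ge t s with ht | ht
      · exact (hv.2 t ht).trans (hw.2 t ht).symm
      · exact congrFun h ⟨t, ht⟩
    refine Nat.le_of_mul_le_mul_right ?_ hm
    calc (∑ v ∈ V s, k v) * m = ∑ v ∈ V s, k v * m := Finset.sum_mul ..
      _ ≤ ∑ v ∈ V s, N := Finset.sum_le_sum fun v hv =>
          card_lowerTriangular_mulVec_eq_zero_mul_le s v (Finset.mem_filter.1 hv).2.1
      _ = (V s).card * N := by simp
      _ ≤ N * m := by rw [mul_comm]; exact Nat.mul_le_mul_left _ hcard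
  have hdisj : ((Finset.univ : Finset (Fin n)) : Set (Fin n)).PairwiseDisjoint V := by
    intro s _ s' _ hss'
    refine Finset.disjoint_left.2 fun v hv hv' => ?_
    simp only [V, Finset.mem_filter, Finset.mem_univ, true_and] at hv hv'
    rcases hss'.lt_or_gt with h | h
    · exact hv.1 (hv'.2 s h)
    · exact hv'.1 (hv.2 s' h)
  have hcover : (Finset.univ : Finset (Fin n → F)) ⊆ {0} ∪ Finset.univ.biUnion V := by
    intro v _
    by_cases hv : v = 0
    · simp [hv]
    · have hne : ({t | v t ≠ 0} : Finset (Fin n)).Nonempty := by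
        obtain ⟨t, ht⟩ := Function.ne_iff.1 hv
        exact ⟨t, by simpa using ht⟩
      refine Finset.mem_union_right _ (Finset.mem_biUnion.2
        ⟨Finset.min' _ hne, Finset.mem_univ _, ?_⟩)
      have hmin := Finset.min'_mem _ hne
      simp only [V, Finset.mem_filter, Finset.mem_univ, true_and] at hmin ⊢
      refine ⟨hmin, fun t ht => ?_⟩
      by_contra h
      exact absurd (Finset.min'_le _ t (by simpa using h)) (not_le.2 ht)
  rw [hswap]
  calc ∑ v, k v ≤ ∑ v ∈ {0} ∪ Finset.univ.biUnion V, k v := Finset.sum_le_sum_of_subset hcover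
    _ ≤ ∑ v ∈ {0}, k v + ∑ v ∈ Finset.univ.biUnion V, k v := by
        rw [← Finset.sum_union_inter]; exact Nat.le_add_right _ _
    _ ≤ N + ∑ s, ∑ v ∈ V s, k v := by
        rw [Finset.sum_singleton, hzero]
        exact Nat.add_le_add_left (Finset.sum_biUnion hdisj).le _
    _ ≤ N + ∑ _s : Fin n, N := Nat.add_le_add_left (Finset.sum_le_sum fun s _ => hV s) _
    _ = (n + 1) * N := by simp; ring

/-- The product of the kernel sizes of `k` independent uniform lower triangular matrices averages
to at most `(n + 1) ^ k`. -/
theorem sum_prod_card_ker_lowerTriangular_le (k : ℕ) :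
    ∑ a : Fin k → {p : Fin n × Fin n // p.2 ≤ p.1} → F,
      ∏ i, Nat.card {v : Fin n → F // (lowerTriangular (a i)).mulVec v = 0}
      ≤ (n + 1) ^ k * Fintype.card (Fin k → {p : Fin n × Fin n // p.2 ≤ p.1} → F) := by
  have h := Finset.prod_univ_sum (fun _ : Fin k => Finset.univ)
    (fun _ (a : {p : Fin n × Fin n // p.2 ≤ p.1} → F) =>
      Nat.card {v : Fin n → F // (lowerTriangular a).mulVec v = 0})
  rw [Fintype.piFinset_univ] at h
  rw [← h, Finset.prod_const, Finset.card_univ, Fintype.card_fin, Fintype.card_fun (α := Fin k),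
    Fintype.card_fin, ← mul_pow]
  exact Nat.pow_le_pow_left sum_card_ker_lowerTriangular_le k

end Counting

/-- Markov's inequality for the rank defect of a product of lower triangular matrices. -/
theorem card_rank_prod_lowerTriangular_lt_mul_le {n k : ℕ} {F : Type*} [Field F] [Fintype F]
    [DecidableEq F] (x : ℝ) :
    (Nat.card {a : Fin k → {p : Fin n × Fin n // p.2 ≤ p.1} → F //
      ((((List.finRange k).reverse.map fun i => lowerTriangular (a i)).prod.rank : ℝ)
        < (n : ℝ) - x)} : ℝ) * (Fintype.card F : ℝ) ^ x
      ≤ ((n : ℝ) + 1) ^ k * Fintype.card (Fin k → {p : Fin n × Fin n // p.2 ≤ p.1} → F) := by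
  classical
  have hF : (1 : ℝ) ≤ Fintype.card F := by exact_mod_cast Fintype.card_pos
  have h := sum_prod_card_ker_lowerTriangular_le (n := n) (F := F) k
  refine le_trans ?_ (by exact_mod_cast h :
    ((∑ a : Fin k → {p : Fin n × Fin n // p.2 ≤ p.1} → F,
      ∏ i, Nat.card {v : Fin n → F // (lowerTriangular (a i)).mulVec v = 0} : ℕ) : ℝ) ≤ _)
  rw [Nat.card_eq_fintype_card, Fintype.card_subtype, ← nsmul_eq_mul, Nat.cast_sum]
  refine (Finset.card_nsmul_le_sum _ _ _ fun a ha => ?_).trans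
    (Finset.sum_le_sum_of_subset_of_nonneg (Finset.filter_subset _ _)
      fun _ _ _ => Nat.cast_nonneg _)
  have ha := (Finset.mem_filter.1 ha).2
  have hr := Matrix.card_le_rank_prod_add_sum
    ((List.finRange k).reverse.map fun i => lowerTriangular (a i))
  rw [List.map_map, List.map_reverse (f := _ ∘ _), List.sum_reverse, ← List.ofFn_eq_map,
    List.sum_ofFn, Fintype.card_fin] at hr
  simp only [Matrix.natCard_ker_eq_pow, Fintype.card_fin]
  rw [Finset.prod_pow_eq_pow_sum, Nat.card_eq_fintype_card, Nat.cast_pow, ← Real.rpow_natCast]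
  refine Real.rpow_le_rpow_of_exponent_le hF ?_
  have hr' : (n : ℝ) ≤ _ := Nat.cast_le.2 hr
  rw [Nat.cast_add] at hr'
  simp only [Function.comp_apply] at hr'
  linarith

/-- If a random variable with values in a finite discrete space is uniform, then probabilities are
normalized counts. -/
theorem toReal_measure_preimage_of_map_eq_uniform {Ω α : Type*} [MeasurableSpace Ω]
    (μ : Measure Ω) [Fintype α] [Nonempty α] [MeasurableSpace α] [DiscreteMeasurableSpace α]
    (X : Ω → α) (hX : μ.map X = (PMF.uniformOfFintype α).toMeasure) (B : Set α) :
    (μ (X ⁻¹' B)).toReal = Nat.card B / Fintype.card α := by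
  classical
  have hae : AEMeasurable X μ := by
    by_contra h
    rw [Measure.map_of_not_aemeasurable h] at hX
    exact IsProbabilityMeasure.ne_zero _ hX.symm
  rw [← Measure.map_apply_of_aemeasurable hae (MeasurableSet.of_discrete), hX,
    PMF.toMeasure_uniformOfFintype_apply B MeasurableSet.of_discrete]
  simp

/-- Lemma DensitySink: A dense random linear code over F₂ is run over
a line network of L lossless links with one transmission per node per time unit,
during (0, N_T]. Node 1 receives the N_T source packets, which are dense, so
D(Q₁) = N_T. For 1 ≤ ℓ ≤ L−1, the packet sent by node ℓ at time t is a uniformly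
random F₂-linear combination (coefficients `c ℓ t s`, i.i.d. uniform, jointly over
all hops/times) of the packets node ℓ received at times s ≤ t; coefficients with
s > t are 0. The density of the decoding matrix Q_L at the sink is at least the
rank of the composite transfer matrix (product of the L−1 local-encoding matrices),
and the claim is: with probability at least 1 − ε this rank — hence D(Q_L) — is at
least N_T − L·log₂(N_T·L/ε). -/
theorem density_sink_lossless_regular {Ω : Type} [MeasurableSpace Ω]
    (μ : Measure Ω) [IsProbabilityMeasure μ]
    (L NT : ℕ) (hL : 1 ≤ L) (hNT : 1 ≤ NT)
    (ε : ℝ) (hε0 : 0 < ε) (hε1 : ε < 1)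
    (c : Fin (L - 1) → Ω → Fin NT → Fin NT → ZMod 2)
    (S : Finset (Fin (L - 1) × Fin NT × Fin NT))
    (hS : ∀ p : Fin (L - 1) × Fin NT × Fin NT, p ∈ S ↔ p.2.2 ≤ p.2.1)
    (hunif : μ.map (fun ω (p : S) => c p.1.1 ω p.1.2.1 p.1.2.2)
      = (PMF.uniformOfFintype (S → ZMod 2)).toMeasure)
    (hzero : ∀ ℓ ω t s, ¬ s ≤ t → c ℓ ω t s = 0)
    (Tcomp : Ω → Matrix (Fin NT) (Fin NT) (ZMod 2))
    (hT : ∀ ω, Tcomp ω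
      = (((List.finRange (L - 1)).reverse.map (fun ℓ => Matrix.of (c ℓ ω))).prod)) :
    (μ {ω | (((Tcomp ω).rank : ℝ))
        < (NT : ℝ) - (L : ℝ) * Real.logb 2 ((NT : ℝ) * L / ε)}).toReal ≤ ε := by
  have hdisc : DiscreteMeasurableSpace (ZMod 2) := ⟨fun _ => trivial⟩
  have hNT' : (1 : ℝ) ≤ NT := by exact_mod_cast hNT
  have hL' : (1 : ℝ) ≤ L := by exact_mod_cast hL
  let e : S ≃ Fin (L - 1) × {p : Fin NT × Fin NT // p.2 ≤ p.1} :=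
    { toFun := fun p => (p.1.1, ⟨p.1.2, (hS p.1).1 p.2⟩)
      invFun := fun p => ⟨(p.1, p.2.1), (hS _).2 p.2.2⟩
      left_inv := fun _ => rfl
      right_inv := fun _ => rfl }
  let E : (S → ZMod 2) ≃ (Fin (L - 1) → {p : Fin NT × Fin NT // p.2 ≤ p.1} → ZMod 2) :=
    (e.arrowCongr (Equiv.refl _)).trans (Equiv.curry _ _ _)
  let X : Ω → S → ZMod 2 := fun ω p => c p.1.1 ω p.1.2.1 p.1.2.2
  set x : ℝ := (L : ℝ) * Real.logb 2 ((NT : ℝ) * L / ε) with hx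
  let B : Set (Fin (L - 1) → {p : Fin NT × Fin NT // p.2 ≤ p.1} → ZMod 2) :=
    {a | (((List.finRange (L - 1)).reverse.map fun i => lowerTriangular (a i)).prod.rank : ℝ)
      < (NT : ℝ) - x}
  have hmat (ω : Ω) (ℓ : Fin (L - 1)) : Matrix.of (c ℓ ω) = lowerTriangular (E (X ω) ℓ) := by
    ext t s
    by_cases h : s ≤ t
    · simp [lowerTriangular, h, E, e, X]
    · simp [lowerTriangular, h, hzero ℓ ω t s h]
  have hevent : {ω | ((Tcomp ω).rank : ℝ) < (NT : ℝ) - x} = X ⁻¹' (E ⁻¹' B) := by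
    ext ω
    simp only [Set.mem_ofPred_eq, Set.mem_preimage, B, hT, hmat]
  have hcardB : Nat.card (E ⁻¹' B) = Nat.card B :=
    Nat.card_congr (E.subtypeEquiv fun _ => Iff.rfl)
  rw [hevent, toReal_measure_preimage_of_map_eq_uniform μ X hunif, hcardB, Fintype.card_congr E]
  set N := Fintype.card (Fin (L - 1) → {p : Fin NT × Fin NT // p.2 ≤ p.1} → ZMod 2)
  have hN : (0 : ℝ) < N := by exact_mod_cast Fintype.card_pos
  have hmarkov : (Nat.card B : ℝ) * ((NT : ℝ) * L / ε) ^ L ≤ ((NT : ℝ) + 1) ^ (L - 1) * N := by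
    have h := card_rank_prod_lowerTriangular_lt_mul_le (n := NT) (k := L - 1) (F := ZMod 2) x
    have hpow : (Fintype.card (ZMod 2) : ℝ) ^ x = ((NT : ℝ) * L / ε) ^ L := by
      rw [ZMod.card, Nat.cast_ofNat, hx, mul_comm, Real.rpow_mul (by norm_num),
        Real.rpow_logb (by norm_num) (by norm_num) (by positivity), Real.rpow_natCast]
    rwa [hpow] at h
  have hbound : ((NT : ℝ) + 1) ^ (L - 1) ≤ ε * ((NT : ℝ) * L / ε) ^ L := by
    obtain ⟨k, rfl⟩ : ∃ k, L = k + 1 := ⟨L - 1, by omega⟩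
    rw [Nat.add_sub_cancel, pow_succ, mul_comm ε, mul_assoc, div_mul_cancel₀ _ hε0.ne']
    have hbase : ((NT : ℝ) + 1) ^ k ≤ ((NT : ℝ) * (k + 1 : ℕ) / ε) ^ k := by
      rcases Nat.eq_zero_or_pos k with rfl | hk
      · simp
      · have hk' : (2 : ℝ) ≤ (k + 1 : ℕ) := by exact_mod_cast Nat.succ_le_succ hk
        refine pow_le_pow_left₀ (by positivity) ?_ k
        rw [le_div_iff₀ hε0]
        nlinarith
    exact hbase.trans (le_mul_of_one_le_right (by positivity) (by nlinarith))
  rw [div_le_iff₀ hN]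
  refine le_of_mul_le_mul_right ?_ (show (0 : ℝ) < ((NT : ℝ) * L / ε) ^ L by positivity)
  nlinarith [mul_le_mul_of_nonneg_right hbound hN.le]
end
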